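/- arXiv:2603.20699 — 2 statements merged into one kernel-verified Lean document; each statement's English description precedes it below -/
import Mathlib

section
/- Let q ∈ {2, 3, 4} and let n = 2m be an even integer with n ≥ 8. The double circulant [n, m] code C(r) over F_q with r = (0, 1, 1, …, 1) has minimum weight exactly 4. -/
open Matrix

/-- An `m × m` matrix is Toeplitz if its entries are constant along diagonals. -/
def IsToeplitz {m : ℕ} {F : Type*} (A : Matrix (Fin m) (Fin m) F) : Prop :=
  ∀ i j i' j' : Fin m, (i : ℕ) + (j' : ℕ) = (i' : ℕ) + (j : ℕ) → A i j = A i' j'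

/-- The double Toeplitz code `C(A) = {(x, xA) : x ∈ F^m}`. -/
def DTcode {m : ℕ} {F : Type*} [Field F] (A : Matrix (Fin m) (Fin m) F) :
    Set (Fin m ⊕ Fin m → F) :=
  {c | ∃ x : Fin m → F, c = Sum.elim x (Matrix.vecMul x A)}

/-- The Hamming weight of a vector: the number of nonzero coordinates. -/
noncomputable def wt {ι : Type*} [Fintype ι] {F : Type*} [Zero F] (v : ι → F) : ℕ :=
  Nat.card {i // v i ≠ 0}

/-- The double circulant code `C(r) = {(x, x R(r)) : x ∈ F^m}` where
`R(r) i j = r (j - i)` is the circulant matrix with first row `r`. -/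
def DCcode {m : ℕ} {F : Type*} [Field F] (r : Fin m → F) :
    Set (Fin m ⊕ Fin m → F) :=
  {c | ∃ x : Fin m → F, c = Sum.elim x (Matrix.vecMul x (Matrix.of fun i j : Fin m => r (j - i)))}

lemma wt_eq {ι : Type*} [Fintype ι] [DecidableEq ι] {F : Type*} [Zero F] [DecidableEq F] (v : ι → F) :
    wt v = (Finset.univ.filter (fun i => v i ≠ 0)).card := by
  unfold wt
  rw [Nat.card_eq_fintype_card, Fintype.card_subtype]

lemma vecMul_r {F : Type*} [Field F] {k : ℕ} (x : Fin (k+4) → F) :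
    Matrix.vecMul x (Matrix.of fun i j : Fin (k+4) =>
      (fun j : Fin (k+4) => if (j : ℕ) = 0 then (0 : F) else 1) (j - i)) =
    fun j => (∑ i, x i) - x j := by
  funext j
  have h : ∀ i : Fin (k+4), ((j - i : Fin (k+4)) : ℕ) = 0 ↔ j = i := by
    intro i
    rw [Fin.val_eq_zero_iff, sub_eq_zero]
  have h2 : ∀ i : Fin (k+4), x i * (if ((j - i : Fin (k+4)) : ℕ) = 0 then (0 : F) else 1)
      = x i - (if j = i then x i else 0) := by
    intro i
    simp only [h i]
    split_ifs <;> simp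
  simp only [Matrix.vecMul, dotProduct, Matrix.of_apply, h2, Finset.sum_sub_distrib]
  simp

/-- For `q ∈ {2,3,4}` and even length `2m ≥ 8`, the double circulant code with
`r = (0,1,1,…,1)` has minimum weight exactly `4`. -/
theorem stmt11 (F : Type*) [Field F] [Fintype F]
    (hF : Fintype.card F = 2 ∨ Fintype.card F = 3 ∨ Fintype.card F = 4)
    (m : ℕ) (hm : 8 ≤ 2 * m) :
    IsLeast {w | ∃ c ∈ DCcode (fun j : Fin m => if (j : ℕ) = 0 then (0 : F) else 1),
      c ≠ 0 ∧ wt c = w} 4 := by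
  classical
  obtain ⟨k, rfl⟩ : ∃ k, m = k + 4 := ⟨m - 4, by omega⟩
  constructor
  · have h01 : (0 : Fin (k+4)) ≠ 1 := by simp [Fin.ext_iff]
    let x : Fin (k+4) → F := Pi.single 0 1 - Pi.single 1 1
    have hs : ∑ i, x i = 0 := by simp [x]
    have hx : ∀ i, x i ≠ 0 ↔ i = 0 ∨ i = 1 := by
      intro i
      by_cases h0 : i = 0
      · subst h0; simp [x]
      · by_cases h1 : i = 1
        · subst h1; simp [x]
        · simp [x, h0, h1]
    refine ⟨_, ⟨x, rfl⟩, ?_, ?_⟩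
    · intro h
      exact (hx 0).2 (Or.inl rfl) (congrFun h (Sum.inl 0))
    · rw [vecMul_r, wt_eq, hs]
      have : (Finset.univ.filter (fun i : Fin (k+4) ⊕ Fin (k+4) =>
          Sum.elim x (fun j => 0 - x j) i ≠ 0)) =
          {Sum.inl 0, Sum.inl 1, Sum.inr 0, Sum.inr 1} := by
        ext i
        rcases i with i | i
        · simpa using hx i
        · simpa using hx i
      rw [this]
      simp [Finset.card_insert_of_notMem]
  · rintro w ⟨c, ⟨x, rfl⟩, hc, rfl⟩
    rw [vecMul_r] at hc ⊢
    rw [wt_eq]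
    by_cases hs : ∑ i, x i = 0
    · rw [hs] at hc ⊢
      have hx : ∃ a, x a ≠ 0 := by
        by_contra! h
        apply hc
        funext i
        rcases i with i | i <;> simp [h]
      obtain ⟨a, ha⟩ := hx
      have hb : ∃ b, b ≠ a ∧ x b ≠ 0 := by
        by_contra! h
        apply ha
        rw [← hs, Finset.sum_eq_single a (fun b _ hb => h b hb) (by simp)]
      obtain ⟨b, hba, hb⟩ := hb
      have h4 : ({Sum.inl a, Sum.inl b, Sum.inr a, Sum.inr b} :
          Finset (Fin (k+4) ⊕ Fin (k+4))).card = 4 := by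
        simp [Finset.card_insert_of_notMem, hba.symm]
      refine h4.symm.le.trans ?_
      apply Finset.card_le_card
      intro i hi
      simp only [Finset.mem_insert, Finset.mem_singleton] at hi
      rcases hi with rfl | rfl | rfl | rfl <;> simp [ha, hb]
    · have : (Finset.univ : Finset (Fin (k+4))).card ≤ (Finset.univ.filter (fun i => Sum.elim x (fun j => (∑ i, x i) - x j) i ≠ 0)).card := by
        apply Finset.card_le_card_of_injOn
          (fun j => if x j = 0 then Sum.inr j else Sum.inl j)
        · intro j _
          by_cases h : x j = 0 <;> simp [h, hs]
        · intro a _ b _ h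
          by_cases h1 : x a = 0 <;> by_cases h2 : x b = 0 <;> simpa [h1, h2] using h
      simp only [Finset.card_univ, Fintype.card_fin] at this
      omega
end

section
/- Let n = 2m be a positive even integer. There exists an m×m Toeplitz matrix A over F_2 such that the double Toeplitz code C(A) has minimum weight at least 5 if and only if n ≥ 16. -/
open Matrix

/-- Boolean to `ZMod 2`. -/
def b2z (b : Bool) : ZMod 2 := if b then 1 else 0

/-- number of `true` values among the first `n`. -/
def cnt (x : ℕ → Bool) : ℕ → ℕ
  | 0 => 0
  | n + 1 => cnt x n + (x n).toNat

/-- XOR of the shifts of `s` selected by `x`. -/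
def conv (s : ℕ) (x : ℕ → Bool) : ℕ → ℕ
  | 0 => 0
  | n + 1 => conv s x n ^^^ (if x n then s >>> n else 0)

/-- popcount of the lowest `n` bits. -/
def pc (y : ℕ) : ℕ → ℕ
  | 0 => 0
  | n + 1 => pc y n + (y >>> n) % 2

/-- Depth first search over all selections of at most `b` rows below `n`. -/
def chk (s m : ℕ) : ℕ → ℕ → ℕ → Bool
  | 0, b, acc => Nat.beq b 4 || Nat.ble (b + 1) (pc acc m)
  | n + 1, b, acc => chk s m n b acc &&
      (Nat.beq b 0 || chk s m n (b - 1) (acc ^^^ (s >>> n)))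

/-- `chk` fails for all numbers whose binary expansion begins with `s`, followed by `k` digits. -/
def allBad (m : ℕ) : ℕ → ℕ → Bool
  | 0, s => !(chk s m m 4 0)
  | k + 1, s => allBad m k (2 * s) && allBad m k (2 * s + 1)

theorem allBad_spec (m k : ℕ) : ∀ s t, allBad m k s = true → t < 2 ^ k →
    chk (s * 2 ^ k + t) m m 4 0 = false := by
  induction k with
  | zero => 
    intro s t h ht
    have : t = 0 := by simpa using ht
    subst this
    simpa [allBad] using h
  | succ k ih =>
    intro s t h ht
    simp only [allBad, Bool.and_eq_true] at h
    rw [pow_succ] at ht ⊢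
    by_cases h' : t < 2 ^ k
    · have := ih _ t h.1 h'
      rwa [show s * (2 ^ k * 2) + t = 2 * s * 2 ^ k + t by ring]
    · have := ih _ (t - 2 ^ k) h.2 (by omega)
      rwa [show s * (2 ^ k * 2) + t = (2 * s + 1) * 2 ^ k + (t - 2 ^ k) by
        obtain ⟨u, rfl⟩ := Nat.exists_eq_add_of_le (not_lt.mp h')
        rw [Nat.add_sub_cancel_left]; ring]

theorem pc_eq (y n : ℕ) : pc y n = cnt y.testBit n := by
  induction n with
  | zero => rfl
  | succ n ih => simp [pc, cnt, ih, Nat.toNat_testBit, Nat.shiftRight_eq_div_pow]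

theorem cnt_congr {x y : ℕ → Bool} {n : ℕ} (h : ∀ i < n, x i = y i) : cnt x n = cnt y n := by
  induction n with
  | zero => rfl
  | succ n ih => rw [cnt, cnt, ih (fun i hi => h i (by omega)), h n (by omega)]

theorem conv_congr (s : ℕ) {x y : ℕ → Bool} {n : ℕ} (h : ∀ i < n, x i = y i) :
    conv s x n = conv s y n := by
  induction n with
  | zero => rfl
  | succ n ih => rw [conv, conv, ih (fun i hi => h i (by omega)), h n (by omega)]

theorem chk_spec (s m n : ℕ) : ∀ b acc, chk s m n b acc = true ↔
    ∀ x : ℕ → Bool, cnt x n ≤ b →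
      (b - cnt x n = 4 ∨ b - cnt x n < pc (acc ^^^ conv s x n) m) := by
  induction n with
  | zero => 
    intro b acc
    simp [chk, cnt, conv]
  | succ n ih =>
    intro b acc
    have key : ∀ (x : ℕ → Bool) (v : Bool), cnt (Function.update x n v) n = cnt x n ∧
        conv s (Function.update x n v) n = conv s x n := by
      intro x v
      have : ∀ i < n, Function.update x n v i = x i := by
        intro i hi
        exact Function.update_of_ne (by omega) _ _
      exact ⟨cnt_congr this, conv_congr s this⟩
    rw [chk, Bool.and_eq_true, ih]
    constructor
    · rintro ⟨h1, h2⟩ x hx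
      rw [cnt] at hx ⊢
      rw [conv]
      cases hxn : x n with
      | false =>
        simp only [hxn, Bool.toNat_false, add_zero] at hx
        simpa using h1 x hx
      | true =>
        simp only [hxn, Bool.toNat_true] at hx
        cases b with
        | zero => omega
        | succ b =>
          simp only [Nat.beq_eq, Nat.add_one_ne_zero, Bool.or_eq_true, false_or,
            Nat.add_sub_cancel] at h2
          rw [ih] at h2
          have := h2 x (by omega)
          simp only [Bool.toNat_true, if_true]
          rw [show b + 1 - (cnt x n + 1) = b - cnt x n by omega]
          rwa [Nat.xor_assoc, Nat.xor_comm (s >>> n)] at this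
    · intro h
      constructor
      · intro x hx
        have := h (Function.update x n false)
        rw [cnt, conv, (key x false).1, (key x false).2] at this
        simp at this
        exact this hx
      · cases b with
        | zero => rfl
        | succ b =>
          simp only [Nat.beq_eq, Nat.add_one_ne_zero, Bool.or_eq_true, false_or,
            Nat.add_sub_cancel]
          rw [ih]
          intro x hx
          have := h (Function.update x n true)
          rw [cnt, conv, (key x true).1, (key x true).2] at this
          simp at this
          rw [Nat.xor_assoc, Nat.xor_comm (s >>> n)]
          exact this hx

/-- The Toeplitz matrix of a sequence. -/
def toep (m : ℕ) (a : ℕ → ZMod 2) : Matrix (Fin m) (Fin m) (ZMod 2) :=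
  fun i j => a (i + (Fin.rev j : Fin m))

theorem toep_isToeplitz (m : ℕ) (a : ℕ → ZMod 2) : IsToeplitz (toep m a) := by
  intro i j i' j' h
  unfold toep
  congr 1
  simp only [Fin.val_rev]
  omega

theorem exists_toep {m : ℕ} (A : Matrix (Fin m) (Fin m) (ZMod 2)) (hA : IsToeplitz A) :
    ∃ a, A = toep m a := by
  classical
  refine ⟨fun k => if h : ∃ p : Fin m × Fin m, (p.1 : ℕ) + (Fin.rev p.2 : Fin m) = k then
    A h.choose.1 h.choose.2 else 0, ?_⟩
  ext i j
  have h : ∃ p : Fin m × Fin m, (p.1 : ℕ) + (Fin.rev p.2 : Fin m) =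
    (i : ℕ) + (Fin.rev j : Fin m) := ⟨(i, j), rfl⟩
  change A i j = dite _ _ _
  rw [dif_pos h]
  apply hA
  have := h.choose_spec
  simp only [Fin.val_rev] at this ⊢
  omega

theorem wt_elim {m : ℕ} (x y : Fin m → ZMod 2) : wt (Sum.elim x y) =
    (∑ i, if x i ≠ 0 then 1 else 0) + ∑ i, if y i ≠ 0 then 1 else 0 := by
  classical
  unfold wt
  rw [Nat.card_eq_fintype_card, Fintype.card_subtype, Finset.card_filter,
    Fintype.sum_sum_type]
  rfl

theorem cnt_eq (x : ℕ → Bool) (m : ℕ) :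
    (∑ i : Fin m, if b2z (x i) ≠ 0 then 1 else 0) = cnt x m := by
  rw [Fin.sum_univ_eq_sum_range (fun i => if b2z (x i) ≠ 0 then 1 else 0)]
  induction m with
  | zero => rfl
  | succ n ih =>
    rw [Finset.sum_range_succ, ih, cnt]
    cases x n <;> simp [b2z]

theorem b2z_xor (a b : Bool) : b2z (a ^^ b) = b2z a + b2z b := by
  revert a b; decide

theorem conv_testBit (s : ℕ) (x : ℕ → Bool) (n p : ℕ) :
    b2z ((conv s x n).testBit p) = ∑ i ∈ Finset.range n, b2z (x i) * b2z (s.testBit (i + p)) := by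
  induction n with
  | zero => simp [conv, b2z]
  | succ n ih =>
    rw [Finset.sum_range_succ, ← ih, conv, Nat.testBit_xor, b2z_xor]
    congr 1
    cases x n <;> simp [b2z]

theorem vecMul_toep (m : ℕ) (a : ℕ → ZMod 2) (x : Fin m → ZMod 2) (j : Fin m) :
    Matrix.vecMul x (toep m a) j = ∑ i, x i * a (i + (Fin.rev j : Fin m)) := rfl

theorem wt_bridge (m s : ℕ) (x : ℕ → Bool) :
    wt (Sum.elim (fun i : Fin m => b2z (x i))
      (Matrix.vecMul (fun i : Fin m => b2z (x i)) (toep m fun k => b2z (s.testBit k)))) =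
    cnt x m + pc (conv s x m) m := by
  rw [wt_elim, cnt_eq, pc_eq, ← cnt_eq (conv s x m).testBit]
  congr 1
  refine (Equiv.sum_comp (Fin.revPerm (n := m)) _).symm.trans ?_
  refine Finset.sum_congr rfl fun j _ => ?_
  rw [vecMul_toep, conv_testBit]
  simp only [Fin.revPerm_apply, Fin.rev_rev]
  rw [Fin.sum_univ_eq_sum_range (fun i => b2z (x i) * b2z (s.testBit (i + j)))]

theorem b2z_surj (z : ZMod 2) : b2z (decide (z ≠ 0)) = z := by
  revert z; decide

theorem lift_fin {m : ℕ} (x : Fin m → ZMod 2) :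
    ∃ y : ℕ → Bool, x = fun i : Fin m => b2z (y i) := by
  refine ⟨fun i => if h : i < m then decide (x ⟨i, h⟩ ≠ 0) else false, ?_⟩
  ext i
  simp only [i.2, dif_pos, b2z_surj]

theorem cnt_eq_zero {x : ℕ → Bool} {m : ℕ} (h : cnt x m = 0) : ∀ i < m, x i = false := by
  induction m with
  | zero => intro i hi; omega
  | succ n ih =>
    rw [cnt] at h
    intro i hi
    rcases Nat.lt_succ_iff_lt_or_eq.mp hi with h' | rfl
    · exact ih (by omega) i h'
    · cases hx : x i
      · rfl
      · simp [hx] at h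

theorem elim_ne_zero {m : ℕ} (A : Matrix (Fin m) (Fin m) (ZMod 2)) (x : Fin m → ZMod 2) :
    Sum.elim x (Matrix.vecMul x A) ≠ 0 ↔ x ≠ 0 := by
  constructor
  · rintro h rfl
    apply h
    rw [Matrix.zero_vecMul]
    ext i
    cases i <;> rfl
  · rintro h h'
    apply h
    ext i
    exact congrFun h' (Sum.inl i)

theorem good_iff_chk (m s : ℕ) :
    (∀ c ∈ DTcode (toep m fun k => b2z (s.testBit k)), c ≠ 0 → 5 ≤ wt c) ↔
      chk s m m 4 0 = true := by
  rw [chk_spec]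
  constructor
  · intro h x hx
    rcases Nat.eq_zero_or_pos (cnt x m) with h0 | h0
    · left; omega
    · right
      have := h _ ⟨fun i => b2z (x i), rfl⟩ ((elim_ne_zero _ _).2 ?_)
      · rw [wt_bridge] at this
        rw [Nat.zero_xor]
        omega
      · intro h'
        rw [← cnt_eq] at h0
        have h2 : ∀ i : Fin m, b2z (x i) = 0 := fun i => congrFun h' i
        simp [h2] at h0
  · rintro h c ⟨x, rfl⟩ hc
    rw [elim_ne_zero] at hc
    obtain ⟨y, rfl⟩ := lift_fin x
    rw [wt_bridge]
    by_contra hlt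
    have := h y (by omega)
    rw [Nat.zero_xor] at this
    have h0 : cnt y m = 0 := by omega
    apply hc
    ext i
    rw [cnt_eq_zero h0 i i.2]
    rfl

theorem not_good (m : ℕ) (h : allBad m (2 * m - 1) 0 = true) :
    ¬ ∃ A : Matrix (Fin m) (Fin m) (ZMod 2), IsToeplitz A ∧
        ∀ c ∈ DTcode A, c ≠ 0 → 5 ≤ wt c := by
  rintro ⟨A, hA, hg⟩
  obtain ⟨a, rfl⟩ := exists_toep A hA
  let s := Nat.ofBits (fun i : Fin (2 * m - 1) => decide (a i ≠ 0))
  have hs : toep m a = toep m fun k => b2z (s.testBit k) := by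
    ext i j
    change a _ = b2z (s.testBit _)
    have hlt : (i : ℕ) + (Fin.rev j : Fin m) < 2 * m - 1 := by
      have := (Fin.rev j).2
      omega
    rw [Nat.testBit_ofBits_lt _ _ hlt, b2z_surj]
  rw [hs, good_iff_chk] at hg
  have := allBad_spec m (2 * m - 1) 0 s h (Nat.ofBits_lt_two_pow _)
  rw [zero_mul, zero_add] at this
  rw [this] at hg
  exact absurd hg (by decide)

theorem good_small (m s : ℕ) (h : chk s m m 4 0 = true) :
    ∃ A : Matrix (Fin m) (Fin m) (ZMod 2), IsToeplitz A ∧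
        ∀ c ∈ DTcode A, c ≠ 0 → 5 ≤ wt c :=
  ⟨_, toep_isToeplitz _ _, (good_iff_chk m s).2 h⟩

theorem toep_unique {m : ℕ} (x : Fin m → ZMod 2) (i0 : Fin m) (h0 : x i0 ≠ 0)
    (hmax : ∀ i, i0 < i → x i = 0) (d : ℕ → ZMod 2)
    (hd : ∀ k : ℕ, (k < (i0 : ℕ) ∨ (i0 : ℕ) + m ≤ k) → d k = 0)
    (hx : Matrix.vecMul x (toep m d) = 0) : ∀ k, d k = 0 := by
  intro k
  induction k using Nat.strong_induction_on with
  | _ k ih =>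
    by_cases hk : k < (i0 : ℕ) ∨ (i0 : ℕ) + m ≤ k
    · exact hd k hk
    · push Not at hk
      have hj := congrFun hx (Fin.rev ⟨k - i0, by omega⟩)
      rw [vecMul_toep, Fin.rev_rev, Finset.sum_eq_single i0] at hj
      · simp only [Pi.zero_apply, mul_eq_zero, h0, false_or] at hj
        rwa [show (i0 : ℕ) + (k - i0) = k by omega] at hj
      · intro i _ hi
        rcases lt_or_gt_of_ne hi with h | h
        · rw [ih _ (by simp only; have : (i : ℕ) < i0 := h; omega), mul_zero]
        · rw [hmax i h, zero_mul]
      · simp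

theorem exists_max {m : ℕ} (x : Fin m → ZMod 2) (hx : x ≠ 0) :
    ∃ i0, x i0 ≠ 0 ∧ ∀ i, i0 < i → x i = 0 := by
  classical
  obtain ⟨i1, h1⟩ := Function.ne_iff.mp hx
  let S := Finset.univ.filter (fun i => x i ≠ 0)
  have hS : S.Nonempty := ⟨i1, by simpa [S] using h1⟩
  refine ⟨S.max' hS, ?_, ?_⟩
  · have := S.max'_mem hS
    simpa [S] using this
  · intro i hi
    by_contra h
    exact absurd (S.le_max' i (by simpa [S] using h)) (not_le.mpr hi)

/-- Extension of a finite sequence by zero. -/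
def ext0 (N : ℕ) (a : Fin N → ZMod 2) (k : ℕ) : ZMod 2 := if h : k < N then a ⟨k, h⟩ else 0

theorem card_light (m : ℕ) :
    Nat.card {c : Fin m ⊕ Fin m → ZMod 2 // wt c ≤ 4} ≤ ∑ w ∈ Finset.range 5, (2 * m).choose w := by
  classical
  let T : Finset (Finset (Fin m ⊕ Fin m)) :=
    (Finset.range 5).biUnion fun w => Finset.powersetCard w Finset.univ
  have hT : T.card ≤ ∑ w ∈ Finset.range 5, (2 * m).choose w := by
    refine Finset.card_biUnion_le.trans (le_of_eq ?_)
    refine Finset.sum_congr rfl fun w _ => ?_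
    rw [Finset.card_powersetCard, Finset.card_univ]
    simp [two_mul]
  refine le_trans ?_ hT
  rw [← Fintype.card_coe, ← Nat.card_eq_fintype_card]
  refine Nat.card_le_card_of_injective
    (fun c => (⟨Finset.univ.filter fun i => c.1 i ≠ 0, ?_⟩ : T)) ?_
  · have h := c.2
    unfold wt at h
    rw [Nat.card_eq_fintype_card, Fintype.card_subtype] at h
    simp only [T, Finset.mem_biUnion, Finset.mem_range, Finset.mem_powersetCard]
    exact ⟨_, by omega, Finset.subset_univ _, rfl⟩
  · intro c c' h
    have h1 := congrArg Subtype.val h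
    apply Subtype.ext
    ext i
    have h2 : (c.1 i ≠ 0) ↔ (c'.1 i ≠ 0) := by
      have := Finset.ext_iff.mp h1 i
      simpa using this
    rw [← b2z_surj (c.1 i), ← b2z_surj (c'.1 i), decide_eq_decide.mpr h2]

theorem arith (m : ℕ) (hm : 15 ≤ m) : ∑ w ∈ Finset.range 5, (2 * m).choose w < 2 ^ m := by
  induction m, hm using Nat.le_induction with
  | base => decide +kernel
  | succ m hm ih =>
    have h4 := Nat.choose_succ_right_eq (2 * m) 3
    have h3 := Nat.choose_succ_right_eq (2 * m) 2
    have h2 := Nat.choose_succ_right_eq (2 * m) 1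
    simp only [Finset.sum_range_succ, Finset.sum_range_zero, Nat.reduceAdd] at *
    have e : 2 * (m + 1) = 2 * m + 1 + 1 := by ring
    have p4 : (2 * m + 1 + 1).choose 4 = (2 * m).choose 2 + 2 * (2 * m).choose 3
      + (2 * m).choose 4 := by
      simp only [Nat.choose_succ_succ' _ 3, Nat.choose_succ_succ' _ 2]; ring
    have p3 : (2 * m + 1 + 1).choose 3 = (2 * m).choose 1 + 2 * (2 * m).choose 2
      + (2 * m).choose 3 := by
      simp only [Nat.choose_succ_succ' _ 2, Nat.choose_succ_succ' _ 1]; ring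
    have p2 : (2 * m + 1 + 1).choose 2 = (2 * m).choose 0 + 2 * (2 * m).choose 1
      + (2 * m).choose 2 := by
      simp only [Nat.choose_succ_succ' _ 1, Nat.choose_succ_succ' _ 0]; ring
    rw [e, p4, p3, p2, pow_succ]
    have q4 := Nat.mul_le_mul_left ((2 * m).choose 3) (show 27 ≤ 2 * m - 3 by omega)
    have q3 := Nat.mul_le_mul_left ((2 * m).choose 2) (show 28 ≤ 2 * m - 2 by omega)
    have q2 := Nat.mul_le_mul_left ((2 * m).choose 1) (show 29 ≤ 2 * m - 1 by omega)
    simp only [Nat.choose_one_right, Nat.choose_zero_right] at *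
    omega

theorem good_large (m : ℕ) (hm : 15 ≤ m) :
    ∃ A : Matrix (Fin m) (Fin m) (ZMod 2), IsToeplitz A ∧
        ∀ c ∈ DTcode A, c ≠ 0 → 5 ≤ wt c := by
  classical
  by_contra hcon
  push Not at hcon
  have hbad : ∀ a : Fin (2 * m - 1) → ZMod 2, ∃ x : Fin m → ZMod 2, x ≠ 0 ∧
      wt (Sum.elim x (Matrix.vecMul x (toep m (ext0 _ a)))) ≤ 4 := by
    intro a
    obtain ⟨c, ⟨x, rfl⟩, h1, h2⟩ := hcon _ (toep_isToeplitz m (ext0 _ a))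
    exact ⟨x, (elim_ne_zero _ _).1 h1, by omega⟩
  have : Nonempty (Fin m) := ⟨⟨0, by omega⟩⟩
  choose X hX0 hX using hbad
  choose! I hI1 hI2 using (fun x : Fin m → ZMod 2 => exists_max x)
  let f : (Fin (2 * m - 1) → ZMod 2) →
      {c : Fin m ⊕ Fin m → ZMod 2 // wt c ≤ 4} × (Fin (m - 1) → ZMod 2) := fun a =>
    (⟨_, hX a⟩, fun k => if (k : ℕ) < I (X a) then ext0 _ a k else ext0 _ a (k + m))
  have hf : Function.Injective f := by
    intro a a' h
    have h1 := congrArg (fun p => p.1.1) h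
    have h2 := congrArg Prod.snd h
    simp only [f] at h1 h2
    have hx : X a = X a' := by
      ext i
      exact congrFun h1 (Sum.inl i)
    rw [← hx] at h1 h2
    have hv : Matrix.vecMul (X a) (toep m (ext0 _ a)) =
        Matrix.vecMul (X a) (toep m (ext0 _ a')) := by
      ext j
      exact congrFun h1 (Sum.inr j)
    have hz := toep_unique (X a) (I (X a)) (hI1 _ (hX0 a)) (hI2 _ (hX0 a))
      (fun k => ext0 _ a k - ext0 _ a' k) ?_ ?_
    · ext k
      have := hz k
      simp only [ext0, k.2, dif_pos, sub_eq_zero] at this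
      exact this
    · have hI := (I (X a)).2
      intro k hk
      by_cases hkN : k < 2 * m - 1
      · rw [sub_eq_zero]
        rcases hk with hk | hk
        · have := congrFun h2 ⟨k, by omega⟩
          simpa [hk] using this
        · have := congrFun h2 ⟨k - m, by omega⟩
          simp only at this
          rwa [if_neg (by omega), if_neg (by omega), Nat.sub_add_cancel (by omega)] at this
      · simp [ext0, hkN]
    · have : toep m (fun k => ext0 _ a k - ext0 _ a' k) =
          toep m (ext0 _ a) - toep m (ext0 _ a') := rfl
      rw [this, Matrix.vecMul_sub, hv, sub_self]
  have hc := Nat.card_le_card_of_injective f hf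
  rw [Nat.card_prod] at hc
  have e1 : ∀ N, Nat.card (Fin N → ZMod 2) = 2 ^ N := by
    intro N
    simp [Nat.card_eq_fintype_card]
  rw [e1, e1] at hc
  have h3 := (card_light m).trans_lt (arith m hm)
  have h4 : 2 ^ (2 * m - 1) = 2 ^ m * 2 ^ (m - 1) := by
    rw [← pow_add]; congr 1; omega
  rw [h4] at hc
  have := Nat.le_of_mul_le_mul_right hc (by positivity)
  omega

/-- Existence of a double Toeplitz code of length 2m over the field with 2
elements having minimum weight at least 5, characterized by the length. -/
theorem stmt12 (m : ℕ) (hm : 1 ≤ m) :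
    (∃ A : Matrix (Fin m) (Fin m) (ZMod 2), IsToeplitz A ∧
        ∀ c ∈ DTcode A, c ≠ 0 → 5 ≤ wt c) ↔ (16 ≤ 2 * m) := by
  constructor
  · intro h
    by_contra hlt
    have h7 : m ≤ 7 := by omega
    interval_cases m
    · exact not_good 1 (by decide +kernel) h
    · exact not_good 2 (by decide +kernel) h
    · exact not_good 3 (by decide +kernel) h
    · exact not_good 4 (by decide +kernel) h
    · exact not_good 5 (by decide +kernel) h
    · exact not_good 6 (by decide +kernel) h
    · exact not_good 7 (by decide +kernel) h
  · intro h
    by_cases h15 : 15 ≤ m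
    · exact good_large m h15
    · have h8 : 8 ≤ m := by omega
      have h14 : m ≤ 14 := by omega
      interval_cases m
      · exact good_small 8 2955 (by decide +kernel)
      · exact good_small 9 5899 (by decide +kernel)
      · exact good_small 10 11787 (by decide +kernel)
      · exact good_small 11 23563 (by decide +kernel)
      · exact good_small 12 47115 (by decide +kernel)
      · exact good_small 13 94219 (by decide +kernel)
      · exact good_small 14 188427 (by decide +kernel)
end
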